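/- arXiv:2404.03897 — 11 statements merged into one kernel-verified Lean document; each statement's English description precedes it below -/
import Mathlib

section
/- For integers k, m, n with m ≠ 0 and n ≥ 1, the n vectors v₁ = m·e₁, v₂ = e₂ − e₁, …, vₙ = eₙ − eₙ₋₁ form a ℤ-basis of L_{k,m,n}, and the determinant of their Gram matrix [(vᵢ|vⱼ)_{k,m,n}]_{1≤i,j≤n} equals m² − mn + kn. -/
open Finset

/-- The latitude of a vector `x ∈ ℚⁿ`: the sum of its coordinates. -/
noncomputable def lat {n : ℕ} (x : Fin n → ℚ) : ℚ := ∑ i, x i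

/-- The symmetric bilinear form `(x|y)_{k,m,n} = x·y + (k-m)·lat(x)·lat(y)/m²` on `ℚⁿ`. -/
noncomputable def form (k m : ℤ) {n : ℕ} (x y : Fin n → ℚ) : ℚ :=
  (∑ i, x i * y i) + (k - m) * lat x * lat y / (m : ℚ) ^ 2

/-- The lattice `L_{k,m,n} = {x ∈ ℤⁿ : m ∣ lat(x)}` (as a subset of `ℚⁿ`). -/
def latt (m : ℤ) (n : ℕ) : Set (Fin n → ℚ) :=
  {x | (∀ i, ∃ a : ℤ, x i = a) ∧ ∃ t : ℤ, lat x = m * t}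

/-- The vectors `v₁ = m·e₁, v₂ = e₂ - e₁, …, vₙ = eₙ - eₙ₋₁` (zero-indexed: `v i` has a
coordinate `m` at position `0` when `i = 0`, and otherwise `1` at position `i` and `-1`
at position `i - 1`). -/
noncomputable def basisVec (m : ℤ) (n : ℕ) : Fin n → Fin n → ℚ :=
  fun i j =>
    if (i : ℕ) = 0 then (if j = i then (m : ℚ) else 0)
    else if j = i then 1 else if (j : ℕ) + 1 = (i : ℕ) then -1 else 0

theorem basisVec_apply (m : ℤ) {n : ℕ} (i j : Fin n) :
    basisVec m n i j = (if i = j then (if (i : ℕ) = 0 then (m : ℚ) else 1) else 0) -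
      if (j : ℕ) + 1 = i then 1 else 0 := by
  unfold basisVec
  rcases eq_or_ne i j with rfl | h
  · simp
  · by_cases h0 : (i : ℕ) = 0
    · simp [h, h.symm, h0]
    · by_cases h1 : (j : ℕ) + 1 = i <;> simp [h, h.symm, h0, h1]

theorem sum_ite_val_eq {n : ℕ} (f : ℕ → ℚ) (t : ℕ) :
    ∑ i : Fin n, (if t = (i : ℕ) then f i else 0) = if t < n then f t else 0 := by
  rw [Fin.sum_univ_eq_sum_range (fun i => if t = i then f i else 0) n]
  simp

theorem sum_ite_succ_val_eq {n : ℕ} (i : Fin n) :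
    ∑ j : Fin n, (if (j : ℕ) + 1 = i then (1 : ℚ) else 0) = if (i : ℕ) = 0 then 0 else 1 := by
  obtain ⟨i, hi⟩ := i
  cases i with
  | zero => simp
  | succ t =>
    have := sum_ite_val_eq (n := n) (fun _ => 1) t
    simpa [eq_comm, (Nat.lt_succ_self t).trans hi] using this

theorem lat_basisVec (m : ℤ) {n : ℕ} (i : Fin n) :
    lat (basisVec m n i) = if (i : ℕ) = 0 then (m : ℚ) else 0 := by
  simp only [lat, basisVec_apply, sum_sub_distrib, sum_ite_succ_val_eq, sum_ite_eq, mem_univ,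
    if_true]
  split_ifs <;> simp

theorem basisVec_mem_latt (m : ℤ) {n : ℕ} (i : Fin n) : basisVec m n i ∈ latt m n := by
  refine ⟨fun j => ?_, if (i : ℕ) = 0 then 1 else 0, ?_⟩
  · refine ⟨(if i = j then (if (i : ℕ) = 0 then m else 1) else 0) -
      if (j : ℕ) + 1 = i then 1 else 0, ?_⟩
    rw [basisVec_apply]
    push_cast
    rfl
  · rw [lat_basisVec]
    split_ifs <;> simp

theorem det_basisVec (m : ℤ) {n : ℕ} (hn : 1 ≤ n) :
    (Matrix.of (basisVec m n)).det = m := by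
  obtain ⟨N, rfl⟩ := Nat.exists_eq_add_of_le' hn
  rw [Matrix.det_of_isLowerTriangular]
  · rw [Fin.prod_univ_succ]
    simp [basisVec_apply]
  · intro i j hij
    have hij : i < j := hij
    have h : (i : ℕ) < j := hij
    simp [basisVec_apply, hij.ne, show ¬ (j : ℕ) + 1 = i by omega]

theorem sum_smul_basisVec (m : ℤ) {n : ℕ} (c : Fin n → ℤ) :
    ∑ i, (c i : ℚ) • basisVec m n i =
      Matrix.vecMul (fun i => (c i : ℚ)) (Matrix.of (basisVec m n)) := by
  ext j
  simp [Matrix.vecMul, dotProduct]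

theorem coefficients_unique (m : ℤ) {n : ℕ} (hm : m ≠ 0) (hn : 1 ≤ n) {c d : Fin n → ℤ}
    (h : ∑ i, (c i : ℚ) • basisVec m n i = ∑ i, (d i : ℚ) • basisVec m n i) : c = d := by
  rw [sum_smul_basisVec, sum_smul_basisVec] at h
  have hB : IsUnit (Matrix.of (basisVec m n)) := by
    rw [Matrix.isUnit_iff_isUnit_det, det_basisVec m hn]
    exact (Int.cast_ne_zero.mpr hm).isUnit
  have h' := Matrix.vecMul_injective_of_isUnit hB h
  ext i
  exact_mod_cast congrFun h' i

theorem exists_coefficients (m : ℤ) {n : ℕ} {x : Fin n → ℚ} (hx : x ∈ latt m n) :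
    ∃ c : Fin n → ℤ, x = ∑ i, (c i : ℚ) • basisVec m n i := by
  obtain ⟨ha, t, ht⟩ := hx
  choose a ha using ha
  let d : ℕ → ℚ := fun s => ∑ l : Fin n, if s ≤ l then x l else 0
  let c : Fin n → ℤ := fun i =>
    if (i : ℕ) = 0 then t else ∑ l : Fin n, if (i : ℕ) ≤ l then a l else 0
  have hc (i : Fin n) (hi : (i : ℕ) ≠ 0) : (c i : ℚ) = d i := by
    simp [c, d, hi, ha]
  have hc0 (i : Fin n) (hi : (i : ℕ) = 0) : (c i : ℚ) * m = d i := by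
    simp only [lat] at ht
    simp [c, d, hi, ht, mul_comm]
  have key (i j : Fin n) : (c i : ℚ) * basisVec m n i j =
      (if i = j then d i else 0) - if (j : ℕ) + 1 = i then d i else 0 := by
    rw [basisVec_apply]
    by_cases hi : (i : ℕ) = 0
    · simpa [hi] using congrArg (fun q : ℚ => if i = j then q else 0) (hc0 i hi)
    · simp [hi, hc i hi, mul_sub]
  have hd (s : ℕ) (hs : ¬ s < n) : d s = 0 :=
    sum_eq_zero fun l _ => if_neg (by omega)
  refine ⟨c, funext fun j => ?_⟩
  have hsucc : (if (j : ℕ) + 1 < n then d (j + 1) else 0) = d (j + 1) := by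
    split_ifs with h
    · rfl
    · exact (hd _ h).symm
  simp only [Finset.sum_apply, Pi.smul_apply, smul_eq_mul, key, sum_sub_distrib, sum_ite_val_eq d, hsucc,
    sum_ite_eq', mem_univ, if_true]
  rw [← sum_sub_distrib, sum_eq_single j]
  · simp
  · intro l _ hl
    have : (l : ℕ) ≠ j := fun h => hl (Fin.ext h)
    by_cases h : (j : ℕ) ≤ l
    · simp [h, show (j : ℕ) + 1 ≤ l by omega]
    · simp [h, show ¬ (j : ℕ) + 1 ≤ l by omega]
  · simp

theorem gram_eq (k m : ℤ) {n : ℕ} (v : Fin n → Fin n → ℚ) :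
    Matrix.of (fun i j => form k m (v i) (v j)) =
      Matrix.of v * (1 + Matrix.vecMulVec (fun _ => (k - m : ℚ) / m ^ 2) 1) *
        (Matrix.of v).transpose := by
  rw [mul_add, mul_one, add_mul, Matrix.mul_vecMulVec, Matrix.vecMulVec_mul]
  ext i j
  simp only [form, lat, Matrix.add_apply, Matrix.mul_apply, Matrix.vecMulVec_apply, Matrix.mulVec,
    Matrix.vecMul, dotProduct, Matrix.of_apply, Matrix.transpose_apply, Pi.one_apply, one_mul,
    ← sum_mul]
  ring

theorem det_gram (k m : ℤ) {n : ℕ} (hm : m ≠ 0) (hn : 1 ≤ n) :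
    Matrix.det (Matrix.of fun i j => form k m (basisVec m n i) (basisVec m n j)) =
      ((m ^ 2 - m * n + k * n : ℤ) : ℚ) := by
  have hm' : (m : ℚ) ≠ 0 := Int.cast_ne_zero.mpr hm
  rw [gram_eq, Matrix.det_mul, Matrix.det_mul, Matrix.det_transpose, det_basisVec m hn,
    Matrix.vecMulVec_eq Unit, Matrix.det_one_add_replicateCol_mul_replicateRow]
  simp only [dotProduct, Pi.one_apply, one_mul, sum_const, card_univ, Fintype.card_fin,
    nsmul_eq_mul]
  push_cast
  field_simp
  ring

/-- The vectors `m·e₁, e₂ - e₁, …, eₙ - eₙ₋₁` form a `ℤ`-basis of `L_{k,m,n}`, and the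
determinant of their Gram matrix equals `m² - mn + kn`. -/
theorem stmt2 (k m : ℤ) (n : ℕ) (hm : m ≠ 0) (hn : 1 ≤ n) :
    (∀ i, basisVec m n i ∈ latt m n) ∧
    (∀ x ∈ latt m n, ∃! c : Fin n → ℤ, x = ∑ i, (c i : ℚ) • basisVec m n i) ∧
    Matrix.det (Matrix.of fun i j => form k m (basisVec m n i) (basisVec m n j)) =
      ((m ^ 2 - m * n + k * n : ℤ) : ℚ) := by
  refine ⟨basisVec_mem_latt m, fun x hx => ?_, det_gram k m hm hn⟩
  obtain ⟨c, hc⟩ := exists_coefficients m hx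
  exact ⟨c, hc, fun d hd => coefficients_unique m hm hn (hd.symm.trans hc)⟩
end

section
/- For integers k, m, n with m ≠ 0 and n ≥ 1, the symmetric bilinear form (·|·)_{k,m,n} on ℚ^n is positive definite if and only if m² − mn + kn > 0. -/
open Finset

/-- The norm of `x`, split into its deviation from Cauchy-Schwarz and its latitude part. -/
theorem card_mul_sq_mul_form_self (k m : ℤ) {n : ℕ} (hm : m ≠ 0) (x : Fin n → ℚ) :
    (n : ℚ) * m ^ 2 * form k m x x =
      m ^ 2 * (n * (∑ i, x i ^ 2) - lat x ^ 2) + lat x ^ 2 * (m ^ 2 - m * n + k * n) := by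
  have hm' : (m : ℚ) ≠ 0 := Int.cast_ne_zero.mpr hm
  simp only [form, ← pow_two]
  field_simp
  ring

/-- The form `(·|·)_{k,m,n}` on `ℚⁿ` is positive definite iff `m² - mn + kn > 0`. -/
theorem stmt3 (k m : ℤ) (n : ℕ) (hm : m ≠ 0) (hn : 1 ≤ n) :
    (∀ x : Fin n → ℚ, x ≠ 0 → 0 < form k m x x) ↔ 0 < m ^ 2 - m * n + k * n := by
  have hn' : (0 : ℚ) < n := by exact_mod_cast hn
  have hm' : (0 : ℚ) < (m : ℚ) ^ 2 := by positivity
  have hD : 0 < m ^ 2 - m * n + k * n ↔ (0 : ℚ) < m ^ 2 - m * n + k * n := by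
    exact_mod_cast Iff.rfl
  rw [hD]
  constructor
  · intro h
    have hone : (fun _ : Fin n => (1 : ℚ)) ≠ 0 := fun e =>
      one_ne_zero (congrFun e ⟨0, hn⟩)
    have hpos := mul_pos (mul_pos hn' hm') (h _ hone)
    rw [card_mul_sq_mul_form_self k m hm] at hpos
    have hlat : lat (fun _ : Fin n => (1 : ℚ)) = n := by simp [lat]
    have hsum : ∑ _i : Fin n, (1 : ℚ) ^ 2 = n := by simp
    rw [hlat, hsum, ← pow_two, sub_self, mul_zero, zero_add] at hpos
    exact pos_of_mul_pos_right hpos (by positivity)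
  · intro h x hx
    refine pos_of_mul_pos_right (a := (n : ℚ) * m ^ 2) ?_ (by positivity)
    rw [card_mul_sq_mul_form_self k m hm]
    have hcs : lat x ^ 2 ≤ n * ∑ i, x i ^ 2 := by
      simpa [lat] using sq_sum_le_card_mul_sum_sq (s := univ) (f := x)
    by_cases hs : lat x = 0
    · obtain ⟨i, hi⟩ := Function.ne_iff.mp hx
      have hi' : x i ≠ 0 := hi
      have hQ : 0 < ∑ i, x i ^ 2 :=
        sum_pos' (fun j _ => sq_nonneg (x j)) ⟨i, mem_univ i, by positivity⟩
      simp only [hs]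
      ring_nf
      positivity
    · exact add_pos_of_nonneg_of_pos (mul_nonneg hm'.le (sub_nonneg.mpr hcs))
        (mul_pos (by positivity) h)
end

section
/- For integers k, m, n with m ≠ 0 and n ≥ 1, if m² − mn + kn = 0, then the symmetric bilinear form (·|·)_{k,m,n} on ℚ^n is positive semidefinite and its radical {x ∈ ℚ^n : (x|y)_{k,m,n} = 0 for all y ∈ ℚ^n} is one-dimensional; i.e. the signature is (n−1, 0, 1). -/
open Finset

/-- When `m² - mn + kn = 0`, the form is `x·y - lat(x)·lat(y)/n`. -/
theorem form_eq_of_degenerate {k m : ℤ} {n : ℕ} (hm : m ≠ 0) (hn : 1 ≤ n)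
    (h : m ^ 2 - m * n + k * n = 0) (x y : Fin n → ℚ) :
    form k m x y = (∑ i, x i * y i) - lat x * lat y / n := by
  have hm' : (m : ℚ) ≠ 0 := by exact_mod_cast hm
  have hn' : (n : ℚ) ≠ 0 := by positivity
  have h' : (m : ℚ) ^ 2 - m * n + k * n = 0 := by exact_mod_cast h
  unfold form
  field_simp
  linear_combination (lat x * lat y) * h'

/-- If `m² - mn + kn = 0`, then the form `(·|·)_{k,m,n}` is positive semidefinite with a
one-dimensional radical; i.e. the signature is `(n-1, 0, 1)`. -/
theorem stmt4 (k m : ℤ) (n : ℕ) (hm : m ≠ 0) (hn : 1 ≤ n)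
    (h : m ^ 2 - m * n + k * n = 0) :
    (∀ x : Fin n → ℚ, 0 ≤ form k m x x) ∧
    ∃ v : Fin n → ℚ, v ≠ 0 ∧
      {x : Fin n → ℚ | ∀ y : Fin n → ℚ, form k m x y = 0} =
        Set.range (fun c : ℚ => c • v) := by
  have hn' : (0 : ℚ) < n := by exact_mod_cast hn
  simp only [form_eq_of_degenerate hm hn h]
  refine ⟨fun x => ?_, fun _ => 1, fun hv => ?_, ?_⟩
  · have hcs := sq_sum_le_card_mul_sum_sq (s := univ) (f := x)
    rw [card_univ, Fintype.card_fin] at hcs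
    rw [sub_nonneg, div_le_iff₀ hn']
    simp only [lat, ← pow_two]
    linarith
  · exact one_ne_zero (congrFun hv ⟨0, hn⟩)
  · ext x
    simp only [Set.mem_ofPred_eq, Set.mem_range]
    constructor
    · intro hx
      refine ⟨lat x / n, funext fun i => ?_⟩
      have hi := hx (Pi.single i 1)
      simp only [Pi.single_apply, mul_ite, mul_one, mul_zero, sum_ite_eq', mem_univ, if_true,
        lat] at hi
      simp only [Pi.smul_apply, smul_eq_mul, mul_one, lat]
      linarith
    · rintro ⟨c, rfl⟩ y
      simp only [lat, Pi.smul_apply, smul_eq_mul, mul_one, sum_const, card_univ,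
        Fintype.card_fin, nsmul_eq_mul, ← mul_sum]
      field_simp
      ring
end

section
/- For integers k, m, n with m ≠ 0 and n ≥ 1, if m² − mn + kn < 0, then the form (·|·)_{k,m,n} is positive definite on the (n−1)-dimensional hyperplane {x ∈ ℚ^n : lat(x) = 0} and there exists a vector v ∈ ℚ^n with (v|v)_{k,m,n} < 0; i.e. the form on ℚ^n has signature (n−1, 1, 0). -/
open Finset

/-- If `m² - mn + kn < 0`, then the form `(·|·)_{k,m,n}` is positive definite on the
hyperplane of latitude-zero vectors and takes a negative value somewhere; i.e. the
signature is `(n-1, 1, 0)`. -/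
theorem stmt5 (k m : ℤ) (n : ℕ) (hm : m ≠ 0) (hn : 1 ≤ n)
    (h : m ^ 2 - m * n + k * n < 0) :
    (∀ x : Fin n → ℚ, lat x = 0 → x ≠ 0 → 0 < form k m x x) ∧
    ∃ v : Fin n → ℚ, form k m v v < 0 := by
  constructor
  · intro x hx hne
    obtain ⟨i, hi⟩ := Function.ne_iff.mp hne
    have hpos : 0 < ∑ i, x i * x i :=
      Finset.sum_pos' (fun j _ => mul_self_nonneg (x j))
        ⟨i, Finset.mem_univ i, mul_self_pos.mpr hi⟩
    simpa [form, hx] using hpos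
  · refine ⟨fun _ => 1, ?_⟩
    have hn' : (0 : ℚ) < n := by exact_mod_cast hn
    have hm' : (m : ℚ) ≠ 0 := by exact_mod_cast hm
    have h' : (m : ℚ) ^ 2 - m * n + k * n < 0 := by exact_mod_cast h
    have key : form k m (fun _ : Fin n => (1 : ℚ)) (fun _ => 1) =
        n * ((m : ℚ) ^ 2 - m * n + k * n) / (m : ℚ) ^ 2 := by
      simp only [form, lat, mul_one, Finset.sum_const, Finset.card_univ, Fintype.card_fin,
        nsmul_eq_mul]
      field_simp
      ring
    rw [key]
    exact div_neg_of_neg_of_pos (mul_neg_of_pos_of_neg hn' h') (by positivity)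
end

section
/- Let k, m, n be integers with m ≠ 0, m ≠ n, and n ≥ 1, and define θ : ℚ^n → ℚ^n by θ(x) = x − (lat(x)/m)·(e₁ + ⋯ + eₙ). Then θ satisfies (θ(x)|θ(y))_{k,n−m,n} = (x|y)_{k,m,n} for all x, y ∈ ℚ^n, and θ restricts to a bijective group homomorphism from L_{k,m,n} onto L_{k,n−m,n}; hence the lattices L_{k,m,n} and L_{k,n−m,n} are isomorphic. -/
open Finset

/-- The map `θ_{m,n}(x) = x - (lat(x)/m)·(e₁ + ⋯ + eₙ)`. -/
noncomputable def theta (m : ℤ) {n : ℕ} (x : Fin n → ℚ) : Fin n → ℚ :=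
  x - (lat x / (m : ℚ)) • ((fun _ => 1) : Fin n → ℚ)

@[simp]
theorem theta_apply (m : ℤ) {n : ℕ} (x : Fin n → ℚ) (i : Fin n) :
    theta m x i = x i - lat x / m := by
  simp [theta]

theorem lat_add {n : ℕ} (x y : Fin n → ℚ) : lat (x + y) = lat x + lat y := by
  simp [lat, Finset.sum_add_distrib]

theorem lat_theta (m : ℤ) {n : ℕ} (x : Fin n → ℚ) :
    lat (theta m x) = lat x - n * (lat x / m) := by
  conv_lhs => simp [lat, Finset.sum_sub_distrib]
  simp [lat]

theorem theta_add (m : ℤ) {n : ℕ} (x y : Fin n → ℚ) :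
    theta m (x + y) = theta m x + theta m y := by
  ext i
  simp only [theta_apply, lat_add, Pi.add_apply]
  ring

theorem dotProduct_theta (m : ℤ) {n : ℕ} (x y : Fin n → ℚ) :
    ∑ i, theta m x i * theta m y i =
      ∑ i, x i * y i - 2 * (lat x * lat y / m) + n * (lat x / m * (lat y / m)) := by
  have h : ∀ i, theta m x i * theta m y i =
      x i * y i - x i * (lat y / m) - lat x / m * y i + lat x / m * (lat y / m) := fun i => by
    simp only [theta_apply]
    ring
  simp only [h, Finset.sum_add_distrib, Finset.sum_sub_distrib, ← Finset.sum_mul,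
    ← Finset.mul_sum, Finset.sum_const, Finset.card_univ, Fintype.card_fin, nsmul_eq_mul]
  change _ - lat x * _ - _ * lat y + _ = _
  ring

theorem form_theta (k : ℤ) {m : ℤ} {n : ℕ} (hm : m ≠ 0) (hmn : m ≠ (n : ℤ))
    (x y : Fin n → ℚ) :
    form k ((n : ℤ) - m) (theta m x) (theta m y) = form k m x y := by
  have hm' : (m : ℚ) ≠ 0 := by exact_mod_cast hm
  have hmn' : (n : ℚ) - m ≠ 0 := sub_ne_zero.2 (by exact_mod_cast hmn.symm)
  simp only [form, dotProduct_theta, lat_theta]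
  push_cast
  field_simp
  ring

theorem theta_theta {m : ℤ} {n : ℕ} (hm : m ≠ 0) (hmn : m ≠ (n : ℤ)) (x : Fin n → ℚ) :
    theta ((n : ℤ) - m) (theta m x) = x := by
  have hm' : (m : ℚ) ≠ 0 := by exact_mod_cast hm
  have hmn' : (n : ℚ) - m ≠ 0 := sub_ne_zero.2 (by exact_mod_cast hmn.symm)
  ext i
  simp only [theta_apply, lat_theta]
  push_cast
  field_simp
  ring

theorem theta_mem_latt {m : ℤ} {n : ℕ} (hm : m ≠ 0) {x : Fin n → ℚ} (hx : x ∈ latt m n) :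
    theta m x ∈ latt ((n : ℤ) - m) n := by
  have hm' : (m : ℚ) ≠ 0 := by exact_mod_cast hm
  obtain ⟨hint, t, ht⟩ := hx
  have hdiv : lat x / m = t := by rw [ht, mul_div_cancel_left₀ _ hm']
  refine ⟨fun i => ?_, -t, ?_⟩
  · obtain ⟨a, ha⟩ := hint i
    exact ⟨a - t, by simp [ha, hdiv]⟩
  · rw [lat_theta, hdiv, ht]
    push_cast
    ring

/-- `θ_{m,n}` is an isometry from `(ℚⁿ, (·|·)_{k,m,n})` to `(ℚⁿ, (·|·)_{k,n-m,n})`, is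
additive, and restricts to a bijection from `L_{k,m,n}` onto `L_{k,n-m,n}`; hence the
lattices `L_{k,m,n}` and `L_{k,n-m,n}` are isomorphic. -/
theorem stmt8 (k m : ℤ) (n : ℕ) (hm : m ≠ 0) (hmn : m ≠ (n : ℤ)) (hn : 1 ≤ n) :
    (∀ x y : Fin n → ℚ, form k ((n : ℤ) - m) (theta m x) (theta m y) = form k m x y) ∧
    (∀ x y : Fin n → ℚ, theta m (x + y) = theta m x + theta m y) ∧
    Set.InjOn (theta m) (latt m n) ∧
    theta m '' latt m n = latt ((n : ℤ) - m) n := by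
  refine ⟨form_theta k hm hmn, theta_add m,
    (Function.LeftInverse.injective (theta_theta hm hmn)).injOn, ?_⟩
  have hm₂ : (n : ℤ) - m ≠ 0 := sub_ne_zero.2 hmn.symm
  have hmn₂ : (n : ℤ) - m ≠ n := by simpa using hm
  ext y
  constructor
  · rintro ⟨x, hx, rfl⟩
    exact theta_mem_latt hm hx
  · intro hy
    refine ⟨theta ((n : ℤ) - m) y, ?_, ?_⟩
    · simpa using theta_mem_latt hm₂ hy
    · simpa using theta_theta hm₂ hmn₂ y
end

section
/- Let k, m, n be integers with m ≠ 0, n ≥ 1, and d := m² − mn + kn ≠ 0. Set s = e₁ + ⋯ + eₙ, e⁰ = (m/d)·s, and eⁱ = eᵢ + ((m−k)/d)·s for 1 ≤ i ≤ n. Then the dual lattice {x ∈ ℚ^n : (x|y)_{k,m,n} ∈ ℤ for all y ∈ L_{k,m,n}} equals the ℤ-span of e⁰, e¹, …, eⁿ. -/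
open Finset

theorem lat_single {n : ℕ} (i : Fin n) (a : ℚ) : lat (Pi.single i a) = a := by
  simp [lat]

theorem lat_sub {n : ℕ} (x y : Fin n → ℚ) : lat (x - y) = lat x - lat y := by
  simp [lat, Finset.sum_sub_distrib]

theorem single_mem_latt (m : ℤ) {n : ℕ} (i : Fin n) :
    (Pi.single i (m : ℚ) : Fin n → ℚ) ∈ latt m n := by
  refine ⟨fun j => ⟨(Pi.single i m : Fin n → ℤ) j, ?_⟩, 1, by simp [lat_single]⟩
  by_cases h : j = i
  · subst h; simp
  · simp [h]

theorem single_sub_single_mem_latt (m : ℤ) {n : ℕ} (i j : Fin n) :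
    (Pi.single i 1 - Pi.single j 1 : Fin n → ℚ) ∈ latt m n := by
  refine ⟨fun l => ⟨(Pi.single i 1 - Pi.single j 1 : Fin n → ℤ) l, ?_⟩, 0, ?_⟩
  · simp [Pi.single_apply]
  · simp [lat_sub, lat_single]

/-- The coordinates of the integral combination `c₀ • e⁰ + ∑ cᵢ • eⁱ`. -/
theorem span_coord {n : ℕ} (a b c₀ : ℚ) (c : Fin n → ℚ) (j : Fin n) :
    (c₀ • (a • ((fun _ => 1) : Fin n → ℚ)) +
      ∑ i, c i • ((Pi.single i 1 : Fin n → ℚ) + b • ((fun _ => 1) : Fin n → ℚ))) j =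
      c j + (c₀ * a + (∑ i, c i) * b) := by
  simp [Finset.sum_apply, Finset.sum_add_distrib, Finset.sum_mul, Pi.single_apply]
  ring

/-- With `d = m² - mn + kn ≠ 0`, `s = e₁ + ⋯ + eₙ`, `e⁰ = (m/d)·s`, and
`eⁱ = eᵢ + ((m-k)/d)·s`, the dual lattice of `L_{k,m,n}` equals the `ℤ`-span of
`e⁰, e¹, …, eⁿ`. -/
theorem stmt9 (k m : ℤ) (n : ℕ) (hm : m ≠ 0) (hn : 1 ≤ n)
    (hd : (m ^ 2 - m * n + k * n : ℤ) ≠ 0) :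
    {x : Fin n → ℚ | ∀ y ∈ latt m n, ∃ z : ℤ, form k m x y = z} =
      {x : Fin n → ℚ | ∃ (c₀ : ℤ) (c : Fin n → ℤ),
        x = (c₀ : ℚ) • (((m : ℚ) / ((m ^ 2 - m * n + k * n : ℤ) : ℚ)) •
              ((fun _ => 1) : Fin n → ℚ)) +
            ∑ i, (c i : ℚ) • ((Pi.single i 1 : Fin n → ℚ) +
              (((m - k : ℤ) : ℚ) / ((m ^ 2 - m * n + k * n : ℤ) : ℚ)) •
                ((fun _ => 1) : Fin n → ℚ))} := by
  have hmQ : (m : ℚ) ≠ 0 := by exact_mod_cast hm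
  set d : ℚ := ((m ^ 2 - m * n + k * n : ℤ) : ℚ) with hdef
  have hdQ : d ≠ 0 := by rw [hdef]; exact_mod_cast hd
  have hdval : d = (m : ℚ) ^ 2 - m * n + k * n := by rw [hdef]; push_cast; ring
  clear_value d
  ext x
  simp only [Set.mem_ofPred_eq, funext_iff, span_coord]
  constructor
  · intro h
    let o : Fin n := ⟨0, hn⟩
    have hdiff : ∀ i, ∃ z : ℤ, x i - x o = z := fun i => by
      obtain ⟨z, hz⟩ := h _ (single_sub_single_mem_latt m i o)
      refine ⟨z, ?_⟩
      rw [← hz]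
      simp [form, lat_sub, lat_single, mul_sub, Finset.sum_sub_distrib, Pi.single_apply]
    choose c hc using hdiff
    obtain ⟨z, hz⟩ := h _ (single_mem_latt m o)
    have hx : ∀ i, x i = c i + x o := fun i => by rw [← hc]; ring
    have hlat : lat x = (∑ i, (c i : ℚ)) + n * x o := by
      rw [lat, Finset.sum_congr rfl fun i _ => hx i]
      simp [Finset.sum_add_distrib]
    have hform : form k m x (Pi.single o (m : ℚ)) = x o * m + (k - m) * lat x * m / m ^ 2 := by
      simp [form, lat_single, Pi.single_apply]
    rw [hform, hlat] at hz
    refine ⟨z, c, fun j => ?_⟩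
    rw [hx j, ← hz]
    congr 1
    push_cast
    field_simp
    rw [hdval]
    ring
  · rintro ⟨c₀, c, hx⟩ y ⟨hy, t, ht⟩
    choose b hb using hy
    set r : ℚ := c₀ * (m / d) + (∑ i, (c i : ℚ)) * (((m - k : ℤ) : ℚ) / d) with hr
    have hrd : r * d = c₀ * m + (∑ i, (c i : ℚ)) * (m - k) := by
      rw [hr]; push_cast; field_simp
    clear_value r
    have hlat : lat x = (∑ i, (c i : ℚ)) + n * r := by
      rw [lat, Finset.sum_congr rfl fun i _ => hx i]
      simp [Finset.sum_add_distrib]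
    have hdot : ∑ i, x i * y i = (∑ i, (c i : ℚ) * b i) + r * (m * t) := by
      rw [← ht, lat, Finset.mul_sum, ← Finset.sum_add_distrib]
      exact Finset.sum_congr rfl fun i _ => by rw [hx i, hb i]; ring
    refine ⟨(∑ i, c i * b i) + c₀ * t, ?_⟩
    rw [form, hdot, hlat, ht]
    push_cast
    rw [hdval] at hrd
    field_simp
    linear_combination (t : ℚ) * hrd
end

section
/- Let V be a finite-dimensional ℚ-vector space with a symmetric bilinear form B, let L ⊆ V be a finitely generated additive subgroup with B(L,L) ⊆ ℤ, let M ⊆ L be a subgroup such that B restricted to the ℚ-span of M is nondegenerate and such that L ∩ (ℚ-span of M) = M, and let M^⊥ = {y ∈ L : B(y, z) = 0 for all z ∈ M}. If M^⊥ is a free abelian group of rank 1, then the quotient group L/(M + M^⊥) is cyclic. -/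
/-- A finitely generated additive subgroup of `ℚ` is cyclic. -/
theorem Rat.exists_eq_zmultiples_of_fg (H : AddSubgroup ℚ) (hH : H.FG) :
    ∃ q : ℚ, H = AddSubgroup.zmultiples q := by
  have hfg : H.toIntSubmodule.FG := by
    rwa [Submodule.fg_iff_addSubgroup_fg, AddSubgroup.toIntSubmodule_toAddSubgroup]
  let I : FractionalIdeal (nonZeroDivisors ℤ) ℚ :=
    ⟨H.toIntSubmodule, FractionalIdeal.isFractional_of_fg hfg⟩
  obtain ⟨q, hq⟩ := (FractionalIdeal.isPrincipal I).principal
  have hq' : H.toIntSubmodule = Submodule.span ℤ {q} := hq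
  refine ⟨q, AddSubgroup.ext fun x => ?_⟩
  have hx : x ∈ H.toIntSubmodule ↔ x ∈ Submodule.span ℤ {q} := by rw [hq']
  rw [Submodule.mem_span_singleton] at hx
  exact hx

/-- Every element of the rational span of a subgroup has a nonzero integer multiple in it. -/
theorem AddSubgroup.exists_zsmul_mem_of_mem_span_rat {V : Type*} [AddCommGroup V] [Module ℚ V]
    (M : AddSubgroup V) {x : V} (hx : x ∈ Submodule.span ℚ (M : Set V)) :
    ∃ n : ℤ, n ≠ 0 ∧ n • x ∈ M := by
  induction hx using Submodule.span_induction with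
  | mem x hx => exact ⟨1, one_ne_zero, by simpa using hx⟩
  | zero => exact ⟨1, one_ne_zero, by simp⟩
  | add x y _ _ ihx ihy =>
    obtain ⟨m, hm, hmx⟩ := ihx
    obtain ⟨n, hn, hny⟩ := ihy
    refine ⟨m * n, mul_ne_zero hm hn, ?_⟩
    have h : (m * n) • (x + y) = n • (m • x) + m • (n • y) := by module
    rw [h]
    exact M.add_mem (M.zsmul_mem hmx n) (M.zsmul_mem hny m)
  | smul q x _ ih =>
    obtain ⟨n, hn, hnx⟩ := ih
    refine ⟨q.den * n, mul_ne_zero (by exact_mod_cast q.den_nz) hn, ?_⟩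
    have h : ((q.den : ℤ) * n) • (q • x) = q.num • (n • x) := by
      simp only [← Int.cast_smul_eq_zsmul ℚ, smul_smul]
      congr 1
      push_cast
      linear_combination (n : ℚ) * q.den_mul_eq_num
    rw [h]
    exact M.zsmul_mem hnx _

/-- Let `V` be a finite-dimensional `ℚ`-vector space with a symmetric bilinear form `B`,
`L ⊆ V` a finitely generated additive subgroup with `B(L,L) ⊆ ℤ`, and `M ⊆ L` a
primitive subgroup (`L ∩ ℚ-span(M) = M`) on whose `ℚ`-span `B` is nondegenerate. If
`M^⊥ = {y ∈ L : B(y,M) = 0}` is free abelian of rank `1`, then `L/(M + M^⊥)` is cyclic,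
i.e. there is `g ∈ L` such that every `x ∈ L` satisfies `x - c·g ∈ M + M^⊥` for some
integer `c`. -/
theorem stmt12 (V : Type*) [AddCommGroup V] [Module ℚ V] [FiniteDimensional ℚ V]
    (B : V →ₗ[ℚ] V →ₗ[ℚ] ℚ) (hsymm : ∀ x y : V, B x y = B y x)
    (L M : AddSubgroup V) (hLfg : L.FG) (hML : M ≤ L)
    (hint : ∀ x ∈ L, ∀ y ∈ L, ∃ z : ℤ, B x y = (z : ℚ))
    (hnd : ∀ x ∈ Submodule.span ℚ (M : Set V),
      (∀ y ∈ Submodule.span ℚ (M : Set V), B x y = 0) → x = 0)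
    (hprim : (L : Set V) ∩ (Submodule.span ℚ (M : Set V) : Set V) = (M : Set V))
    (hrk1 : ∃ v ∈ {y : V | y ∈ L ∧ ∀ z ∈ M, B y z = 0}, v ≠ 0 ∧
      ∀ w ∈ {y : V | y ∈ L ∧ ∀ z ∈ M, B y z = 0}, ∃ c : ℤ, w = c • v) :
    ∃ g ∈ L, ∀ x ∈ L, ∃ c : ℤ, ∃ a ∈ M,
      ∃ b ∈ {y : V | y ∈ L ∧ ∀ z ∈ M, B y z = 0}, x - c • g = a + b := by
  set W := Submodule.span ℚ (M : Set V) with hW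
  obtain ⟨v, ⟨-, hvM⟩, hv0, hv⟩ := hrk1
  have hrefl : LinearMap.BilinForm.IsRefl B := fun x y h => by rw [hsymm, h]
  have hcompl : IsCompl W (LinearMap.BilinForm.orthogonal B W) := by
    refine LinearMap.BilinForm.isCompl_orthogonal_of_restrict_nondegenerate hrefl
      ⟨fun x hx => ?_, fun x hx => ?_⟩
    · exact Subtype.ext (hnd x x.2 fun y hy => hx ⟨y, hy⟩)
    · exact Subtype.ext (hnd x x.2 fun y hy => (hsymm _ _).trans (hx ⟨y, hy⟩))
  have hvW : v ∉ W := fun h => hv0 <| hnd v h fun y hy => by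
    have hle : W ≤ LinearMap.ker (B v) := Submodule.span_le.2 hvM
    exact hle hy
  obtain ⟨f, hfv, hf⟩ := Submodule.exists_le_ker_of_notMem hvW
  have hker : ∀ x ∈ L, f x = 0 → x ∈ M := by
    intro x hx hfx
    obtain ⟨w, hw, p, hp, rfl⟩ :=
      Submodule.mem_sup.1 (hcompl.sup_eq_top ▸ Submodule.mem_top (x := x))
    obtain ⟨n, hn, hnw⟩ := M.exists_zsmul_mem_of_mem_span_rat hw
    have hnp : n • p ∈ L := by
      have h := L.sub_mem (L.zsmul_mem hx n) (hML hnw)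
      rwa [smul_add, add_sub_cancel_left] at h
    obtain ⟨c, hc⟩ := hv (n • p) ⟨hnp, fun z hz => by
      have hzp : B z p = 0 := hp z (Submodule.subset_span hz)
      simp [hsymm p z, hzp]⟩
    have hfp : f p = 0 := by
      have hfw : f w = 0 := hf hw
      simpa [hfw] using hfx
    have hc0 : c = 0 := by
      have h := congrArg f hc
      simpa [hfp, hfv] using h
    have hp0 : p = 0 := by
      rw [hc0, zero_smul, ← Int.cast_smul_eq_zsmul ℚ] at hc
      exact (smul_eq_zero.1 hc).resolve_left (Int.cast_ne_zero.2 hn)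
    have hmem : w + p ∈ (L : Set V) ∩ (W : Set V) := ⟨hx, by simpa [hp0] using hw⟩
    rwa [hprim] at hmem
  have hfg : (L.map f.toAddMonoidHom).FG := by
    obtain ⟨S, hS, hfin⟩ := (AddSubgroup.fg_iff L).1 hLfg
    exact (AddSubgroup.fg_iff _).2
      ⟨Set.image f.toAddMonoidHom S, by rw [← AddMonoidHom.map_closure, hS], hfin.image _⟩
  obtain ⟨q, hq⟩ := Rat.exists_eq_zmultiples_of_fg _ hfg
  obtain ⟨g, hg, hgq⟩ : q ∈ L.map f.toAddMonoidHom := hq ▸ AddSubgroup.mem_zmultiples q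
  have hgq' : f g = q := hgq
  refine ⟨g, hg, fun x hx => ?_⟩
  obtain ⟨c, hc⟩ : f x ∈ AddSubgroup.zmultiples q := hq ▸ AddSubgroup.mem_map_of_mem _ hx
  have hc' : c • q = f x := hc
  refine ⟨c, x - c • g, hker _ (L.sub_mem hx (L.zsmul_mem hg c)) ?_, 0,
    ⟨L.zero_mem, by simp⟩, (add_zero _).symm⟩
  rw [map_sub, map_zsmul, hgq', hc', sub_self]
end

section
/- Let k, m, n be integers with 1 ≤ m ≤ n. If the lattice L_{k,m,n} is a root lattice, i.e. the form (·|·)_{k,m,n} is positive definite on ℚ^n and L_{k,m,n} is generated as an additive group by its elements x with (x|x)_{k,m,n} = 2, then k = 2. -/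
open Finset

theorem lat_neg {n : ℕ} (x : Fin n → ℚ) : lat (-x) = -lat x := by
  simp [lat]

theorem form_sub_self (k m : ℤ) {n : ℕ} (x y : Fin n → ℚ) :
    form k m (x - y) (x - y) = form k m x x - 2 * form k m y x + form k m y y := by
  have h : ∑ i, (x - y) i * (x - y) i
      = ∑ i, x i * x i - 2 * ∑ i, y i * x i + ∑ i, y i * y i := by
    rw [mul_sum, ← sum_sub_distrib, ← sum_add_distrib]
    exact sum_congr rfl fun i _ => by simp only [Pi.sub_apply]; ring
  simp only [form, h, lat_sub]
  ring

theorem form_neg_self (k m : ℤ) {n : ℕ} (x : Fin n → ℚ) :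
    form k m (-x) (-x) = form k m x x := by
  simp [form, lat_neg]

theorem neg_mem_latt {m : ℤ} {n : ℕ} {x : Fin n → ℚ} (hx : x ∈ latt m n) : -x ∈ latt m n := by
  obtain ⟨h, t, ht⟩ := hx
  refine ⟨fun i => ?_, -t, by rw [lat_neg, ht]; push_cast; ring⟩
  obtain ⟨a, ha⟩ := h i
  exact ⟨-a, by simp [ha]⟩

theorem sub_mem_latt {m : ℤ} {n : ℕ} {x y : Fin n → ℚ} (hx : x ∈ latt m n)
    (hy : y ∈ latt m n) : x - y ∈ latt m n := by
  obtain ⟨h, t, ht⟩ := hx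
  obtain ⟨h', t', ht'⟩ := hy
  refine ⟨fun i => ?_, t - t', by rw [lat_sub, ht, ht']; push_cast; ring⟩
  obtain ⟨a, ha⟩ := h i
  obtain ⟨b, hb⟩ := h' i
  exact ⟨a - b, by simp [ha, hb]⟩

/-- On integral vectors of latitudes `m * s` and `m * t`, the form is an integer. -/
theorem form_eq_of_lat {k m : ℤ} {n : ℕ} (hm : m ≠ 0) {x y : Fin n → ℚ} {s t : ℤ}
    (hx : lat x = m * s) (hy : lat y = m * t) :
    form k m x y = ∑ i, x i * y i + (k - m) * s * t := by
  have : (m : ℚ) ≠ 0 := by exact_mod_cast hm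
  rw [form, hx, hy]
  field_simp

theorem exists_int_form {k m : ℤ} {n : ℕ} (hm : m ≠ 0) {x y : Fin n → ℚ}
    (hx : x ∈ latt m n) (hy : y ∈ latt m n) : ∃ p : ℤ, form k m x y = p := by
  obtain ⟨h, s, hs⟩ := hx
  obtain ⟨h', t, ht⟩ := hy
  choose a ha using h
  choose b hb using h'
  refine ⟨∑ i, a i * b i + (k - m) * s * t, ?_⟩
  rw [form_eq_of_lat hm hs ht]
  simp [ha, hb]

theorem lat_comp_perm {n : ℕ} (σ : Equiv.Perm (Fin n)) (x : Fin n → ℚ) :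
    lat (x ∘ σ) = lat x :=
  Equiv.sum_comp σ x

theorem form_comp_perm (k m : ℤ) {n : ℕ} (σ : Equiv.Perm (Fin n)) (x y : Fin n → ℚ) :
    form k m (x ∘ σ) (y ∘ σ) = form k m x y := by
  simp only [form, lat_comp_perm]
  congr 1
  exact Equiv.sum_comp σ fun i => x i * y i

theorem comp_perm_mem_latt {m : ℤ} {n : ℕ} (σ : Equiv.Perm (Fin n)) {x : Fin n → ℚ}
    (hx : x ∈ latt m n) : x ∘ σ ∈ latt m n :=
  ⟨fun i => hx.1 (σ i), by rw [lat_comp_perm]; exact hx.2⟩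

theorem sum_form_comp_addLeft (k m : ℤ) {n : ℕ} [NeZero n] (x y : Fin n → ℚ) :
    n * ∑ c : Fin n, form k m (x ∘ Equiv.addLeft c) y
      = lat x * lat y * form k m (1 : Fin n → ℚ) 1 := by
  have h : ∑ c : Fin n, ∑ i, (x ∘ Equiv.addLeft c) i * y i = lat x * lat y := by
    rw [sum_comm]
    simp only [lat, mul_sum, ← sum_mul]
    refine sum_congr rfl fun i _ => ?_
    congr 1
    exact Equiv.sum_comp (Equiv.addRight i) x
  have h1 : lat (1 : Fin n → ℚ) = n := by simp [lat]
  simp only [form, lat_comp_perm, sum_add_distrib, h, h1]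
  simp
  ring

/-- Two vectors of positive latitude have positive product after permuting coordinates. -/
theorem exists_perm_form_pos {k m : ℤ} {n : ℕ} [NeZero n]
    (hpos : ∀ x : Fin n → ℚ, x ≠ 0 → 0 < form k m x x) {x y : Fin n → ℚ}
    (hx : 0 < lat x) (hy : 0 < lat y) :
    ∃ σ : Equiv.Perm (Fin n), 0 < form k m (x ∘ σ) y := by
  by_contra! h
  have h1 := hpos 1 one_ne_zero
  have h2 := sum_form_comp_addLeft k m x y
  have h3 : ∑ c : Fin n, form k m (x ∘ Equiv.addLeft c) y ≤ 0 :=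
    sum_nonpos fun c _ => h _
  have h4 : (0 : ℚ) ≤ n := Nat.cast_nonneg n
  have h5 := mul_pos (mul_pos hx hy) h1
  nlinarith [mul_nonpos_of_nonneg_of_nonpos h4 h3]

/-- The vectors of `L_{k,m,n}` of squared norm `2`. -/
def rootSet (k m : ℤ) (n : ℕ) : Set (Fin n → ℚ) :=
  {y | y ∈ latt m n ∧ form k m y y = 2}

/-- Two roots with positive product are equal or differ by a root. -/
theorem eq_or_sub_mem_rootSet {k m : ℤ} {n : ℕ} (hm : m ≠ 0)
    (hpos : ∀ x : Fin n → ℚ, x ≠ 0 → 0 < form k m x x) {x y : Fin n → ℚ}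
    (hx : x ∈ rootSet k m n) (hy : y ∈ rootSet k m n) (hxy : 0 < form k m x y) :
    y = x ∨ y - x ∈ rootSet k m n := by
  refine or_iff_not_imp_left.2 fun hne => ⟨sub_mem_latt hy.1 hx.1, ?_⟩
  obtain ⟨p, hp⟩ := exists_int_form (k := k) hm hx.1 hy.1
  have h := hpos (y - x) (sub_ne_zero.2 hne)
  rw [form_sub_self, hx.2, hy.2, hp] at h ⊢
  rw [hp] at hxy
  have h1 : 0 < p := by exact_mod_cast hxy
  have h2 : (p : ℚ) < 2 := by linarith
  have h3 : p < 2 := by exact_mod_cast h2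
  obtain rfl : p = 1 := by omega
  norm_num

/-- The least positive level of a root divides every positive level of a root. -/
theorem dvd_level_of_pos {k m : ℤ} {n : ℕ} [NeZero n] (hm : 0 < m)
    (hpos : ∀ x : Fin n → ℚ, x ≠ 0 → 0 < form k m x x) {d : ℕ} (hd : 0 < d)
    {a : Fin n → ℚ} (ha : a ∈ rootSet k m n) (had : lat a = m * d)
    (hmin : ∀ x ∈ rootSet k m n, ∀ s : ℕ, 0 < s → lat x = m * s → d ≤ s) (s : ℕ) :
    ∀ x ∈ rootSet k m n, 0 < s → lat x = m * s → d ∣ s := by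
  have hm' : (0 : ℚ) < m := by exact_mod_cast hm
  induction s using Nat.strong_induction_on with
  | _ s ih =>
    intro x hx hs hxs
    have hds := hmin x hx s hs hxs
    obtain ⟨σ, hσ⟩ := exists_perm_form_pos hpos (x := a) (y := x)
      (by rw [had]; positivity) (by rw [hxs]; positivity)
    have haσ : a ∘ σ ∈ rootSet k m n :=
      ⟨comp_perm_mem_latt σ ha.1, by rw [form_comp_perm]; exact ha.2⟩
    obtain rfl | hlt := hds.eq_or_lt
    · exact dvd_rfl
    rcases eq_or_sub_mem_rootSet hm.ne' hpos haσ hx hσ with h | h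
    · rw [h, lat_comp_perm, had] at hxs
      have : (d : ℚ) = s := mul_left_cancel₀ hm'.ne' hxs
      exact (Nat.cast_injective this).dvd
    · have := ih (s - d) (by omega) _ h (by omega)
        (by rw [lat_sub, lat_comp_perm, had, hxs, Nat.cast_sub hds]; ring)
      exact (Nat.dvd_sub_iff_left hds dvd_rfl).1 this

/-- A root lattice `L_{k,m,n}` containing a vector of level `1` has a root of level `1`. -/
theorem exists_root_level_one {k m : ℤ} {n : ℕ} [NeZero n] (hm : 0 < m)
    (hpos : ∀ x : Fin n → ℚ, x ≠ 0 → 0 < form k m x x) {e : Fin n → ℚ} (he : lat e = m)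
    (hgen : e ∈ AddSubgroup.closure (rootSet k m n)) :
    ∃ a ∈ rootSet k m n, lat a = m := by
  classical
  have hm' : (m : ℚ) ≠ 0 := by exact_mod_cast hm.ne'
  have hdvd : ∀ d : ℤ, (∀ x ∈ rootSet k m n, ∃ t : ℤ, lat x = m * (d * t)) → d ∣ 1 := by
    intro d hd
    have hmem : ∃ t : ℤ, lat e = m * (d * t) := by
      clear he
      induction hgen using AddSubgroup.closure_induction with
      | mem x hx => exact hd x hx
      | zero => exact ⟨0, by simp [lat]⟩
      | add x y _ _ hx hy =>
        obtain ⟨s, hs⟩ := hx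
        obtain ⟨t, ht⟩ := hy
        exact ⟨s + t, by rw [lat_add, hs, ht]; push_cast; ring⟩
      | neg x _ hx =>
        obtain ⟨s, hs⟩ := hx
        exact ⟨-s, by rw [lat_neg, hs]; push_cast; ring⟩
    obtain ⟨t, ht⟩ := hmem
    have h : (m : ℚ) * 1 = m * (d * t) := by rw [mul_one, ← ht, he]
    have h' := mul_left_cancel₀ hm' h
    exact ⟨t, by exact_mod_cast h'⟩
  have hneg : ∀ x ∈ rootSet k m n, -x ∈ rootSet k m n := fun x hx =>
    ⟨neg_mem_latt hx.1, by rw [form_neg_self]; exact hx.2⟩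
  have hlevel : ∀ d : ℕ, (∀ s : ℕ, ∀ x ∈ rootSet k m n, 0 < s → lat x = m * s → d ∣ s) →
      d = 1 := by
    intro d hd
    have := hdvd d fun x hx => by
      obtain ⟨t, ht⟩ := hx.1.2
      have hdt : (d : ℤ) ∣ t := by
        rcases lt_trichotomy t 0 with h | rfl | h
        · have hc : (t.natAbs : ℤ) = -t := by omega
          have hq : (t.natAbs : ℚ) = -t := by rw [← Int.cast_natCast, hc, Int.cast_neg]
          exact Int.natCast_dvd.2 (hd t.natAbs (-x) (hneg x hx) (by omega)
            (by rw [lat_neg, ht, hq]; ring))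
        · exact dvd_zero _
        · have hc : (t.natAbs : ℤ) = t := by omega
          have hq : (t.natAbs : ℚ) = t := by rw [← Int.cast_natCast, hc]
          exact Int.natCast_dvd.2 (hd t.natAbs x hx (by omega) (by rw [ht, hq]))
      obtain ⟨u, rfl⟩ := hdt
      exact ⟨u, by rw [ht]; push_cast; ring⟩
    exact Nat.dvd_one.1 (by exact_mod_cast this)
  have hex : ∃ s : ℕ, 0 < s ∧ ∃ x ∈ rootSet k m n, lat x = m * s := by
    by_contra! h
    exact zero_ne_one (hlevel 0 fun s x hx hs hxs => absurd hxs (h s hs x hx))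
  obtain ⟨hd, a, ha, had⟩ := Nat.find_spec hex
  have h1 := hlevel _ (dvd_level_of_pos hm hpos hd ha had
    fun x hx s hs hxs => Nat.find_min' hex ⟨hs, x, hx, hxs⟩)
  exact ⟨a, ha, by rw [had, h1]; simp⟩

theorem exists_mem_latt_level_one {k m : ℤ} {n : ℕ} (h1 : 1 ≤ m) (h2 : m ≤ (n : ℤ)) :
    ∃ e ∈ latt m n, lat e = m ∧ form k m e e = k := by
  obtain ⟨s, -, hs⟩ := exists_subset_card_eq (s := (univ : Finset (Fin n))) (n := m.toNat)
    (by simp; omega)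
  have hc : (#s : ℤ) = m := by omega
  have hq : (#s : ℚ) = m := by exact_mod_cast congrArg (Int.cast (R := ℚ)) hc
  have hl : lat (fun i => if i ∈ s then (1 : ℚ) else 0) = m := by simp [lat, hq]
  refine ⟨fun i => if i ∈ s then 1 else 0, ⟨fun i => ?_, 1, by simp [hl]⟩, hl, ?_⟩
  · by_cases h : i ∈ s
    · exact ⟨1, by simp [h]⟩
    · exact ⟨0, by simp [h]⟩
  · rw [form_eq_of_lat (s := 1) (t := 1) (by omega) (by simp [hl]) (by simp [hl])]
    simp [hq]

/-- If `1 ≤ m ≤ n` and `L_{k,m,n}` is a root lattice (positive definite and generated by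
its vectors of squared norm `2`), then `k = 2`. -/
theorem stmt15 (k m : ℤ) (n : ℕ) (h1 : 1 ≤ m) (h2 : m ≤ (n : ℤ))
    (hpos : ∀ x : Fin n → ℚ, x ≠ 0 → 0 < form k m x x)
    (hgen : ∀ x ∈ latt m n,
      x ∈ AddSubgroup.closure {y : Fin n → ℚ | y ∈ latt m n ∧ form k m y y = 2}) :
    k = 2 := by
  have : NeZero n := ⟨by omega⟩
  obtain ⟨e, he, hel, hek⟩ := exists_mem_latt_level_one (k := k) h1 h2
  have hk : 0 < k := by
    have he0 : e ≠ 0 := by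
      rintro rfl
      have h : (m : ℚ) = 0 := by rw [← hel]; simp [lat]
      have : m = 0 := by exact_mod_cast h
      omega
    have h := hpos e he0
    rw [hek] at h
    exact_mod_cast h
  obtain ⟨a, ⟨⟨ha, -⟩, ha2⟩, hal⟩ := exists_root_level_one (by omega) hpos hel (hgen e he)
  rw [form_eq_of_lat (s := 1) (t := 1) (by omega) (by simp [hal]) (by simp [hal])] at ha2
  choose b hb using ha
  simp only [lat, hb] at hal ha2
  have hsum : ∑ i, b i = m := by exact_mod_cast hal
  have hnorm : ∑ i, b i * b i + (k - m) * 1 * 1 = 2 := by exact_mod_cast ha2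
  have hdiff : ∑ i, b i * b i - ∑ i, b i = ∑ i, b i * (b i - 1) := by
    rw [← sum_sub_distrib]
    exact sum_congr rfl fun i _ => by ring
  have hnonneg : 0 ≤ ∑ i, b i * (b i - 1) := sum_nonneg fun i _ => by
    rcases le_or_gt (b i) 0 with h | h
    · exact mul_nonneg_of_nonpos_of_nonpos h (by omega)
    · exact mul_nonneg h.le (by omega)
  have heven : (2 : ℤ) ∣ ∑ i, b i * (b i - 1) :=
    dvd_sum fun i _ => (Int.even_mul_pred_self (b i)).two_dvd
  omega
end

section
/- Let k, m, n be integers with 1 ≤ m ≤ n − 1. Then L_{k,m,n} is positive definite and unimodular (i.e. the form (·|·)_{k,m,n} is positive definite on ℚ^n and m² − mn + kn = 1) if and only if there exist nonnegative integers p, q satisfying k² − 1 = p·q, m = k + p, and n = 2k + p + q. -/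
open Finset

/-- The form is positive definite as soon as `m ≠ 0`, `n > 0` and its determinant on the lattice
is `1`. -/
theorem form_self_pos {k m : ℤ} {n : ℕ} (hm : m ≠ 0) (hn : 0 < n)
    (hdet : m ^ 2 - m * n + k * n = 1) {x : Fin n → ℚ} (hx : x ≠ 0) : 0 < form k m x x := by
  have hmQ : (0 : ℚ) < (m : ℚ) ^ 2 := by positivity
  have hm1 : (1 : ℚ) ≤ (m : ℚ) ^ 2 := by
    have : 0 < m ^ 2 := by positivity
    exact_mod_cast this
  have hnQ : (0 : ℚ) < n := by exact_mod_cast hn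
  have hdetQ : (m : ℚ) ^ 2 - m * n + k * n = 1 := by exact_mod_cast hdet
  have hcs : lat x ^ 2 ≤ n * ∑ i, x i * x i := by
    simpa [lat, pow_two] using sq_sum_le_card_mul_sum_sq (s := univ) (f := x)
  have hpos : 0 < ∑ i, x i * x i := by
    obtain ⟨i, hi⟩ := Function.ne_iff.mp hx
    exact sum_pos' (fun j _ => mul_self_nonneg (x j)) ⟨i, mem_univ i, mul_self_pos.mpr hi⟩
  have hscaled : (n * (m : ℚ) ^ 2) * form k m x x =
      n * ∑ i, x i * x i + ((m : ℚ) ^ 2 - 1) * (n * (∑ i, x i * x i) - lat x ^ 2) := by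
    have : (m : ℚ) ^ 2 * form k m x x =
        (m : ℚ) ^ 2 * (∑ i, x i * x i) + (k - m) * lat x * lat x := by
      rw [form, mul_add, mul_div_cancel₀ _ hmQ.ne']
    linear_combination (n : ℚ) * this + lat x ^ 2 * hdetQ
  refine pos_of_mul_pos_right (a := n * (m : ℚ) ^ 2) ?_ (by positivity)
  rw [hscaled]
  exact add_pos_of_pos_of_nonneg (mul_pos hnQ hpos)
    (mul_nonneg (sub_nonneg.mpr hm1) (sub_nonneg.mpr hcs))

/-- For `1 ≤ m ≤ n - 1`, the lattice `L_{k,m,n}` is positive definite and unimodular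
(i.e. `m² - mn + kn = 1`) if and only if there exist nonnegative integers `p, q` with
`k² - 1 = pq`, `m = k + p`, and `n = 2k + p + q`. -/
theorem stmt17 (k m : ℤ) (n : ℕ) (h1 : 1 ≤ m) (h2 : m ≤ (n : ℤ) - 1) :
    ((∀ x : Fin n → ℚ, x ≠ 0 → 0 < form k m x x) ∧ m ^ 2 - m * n + k * n = 1) ↔
    ∃ p q : ℤ, 0 ≤ p ∧ 0 ≤ q ∧ k ^ 2 - 1 = p * q ∧ m = k + p ∧
      (n : ℤ) = 2 * k + p + q := by
  constructor
  · rintro ⟨-, hdet⟩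
    have hn : (0 : ℤ) < n := by linarith
    refine ⟨m - k, n - m - k, ?_, ?_, by linear_combination hdet, by ring, by ring⟩
    · refine nonneg_of_mul_nonneg_right (a := (n : ℤ)) ?_ hn
      nlinarith
    · refine nonneg_of_mul_nonneg_right (a := (n : ℤ)) ?_ hn
      nlinarith
  · rintro ⟨p, q, -, -, hpq, rfl, hn⟩
    have hdet : (k + p) ^ 2 - (k + p) * n + k * n = 1 := by
      linear_combination hpq - p * hn
    exact ⟨fun x hx => form_self_pos (by lia) (by lia) hdet hx, hdet⟩
end

section
/- Let k, m, n be integers with 1 ≤ k ≤ m ≤ n − 1, let ℬ be a set of m-element subsets of {1, …, n}, and for I ∈ ℬ set e_I = Σ_{i∈I} eᵢ ∈ L_{k,m,n}. Then E(ℬ) = {e_I : I ∈ ℬ} is an orthogonal k-frame of L_{k,m,n} (i.e. E(ℬ) consists of n pairwise orthogonal vectors, each of squared norm k, with respect to (·|·)_{k,m,n}) if and only if ℬ has exactly n elements and |I ∩ J| = m − k for every pair of distinct I, J ∈ ℬ (that is, ({1,…,n}, ℬ) is a symmetric 2-(n, m, m−k) design). -/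
open Finset

/-- The characteristic vector `e_I = ∑_{i ∈ I} eᵢ` of a subset `I ⊆ {1, …, n}`. -/
noncomputable def eSet {n : ℕ} (I : Finset (Fin n)) : Fin n → ℚ :=
  fun j => if j ∈ I then 1 else 0

theorem eSet_injective {n : ℕ} : Function.Injective (eSet (n := n)) := by
  intro I J h
  ext j
  have hj := congrFun h j
  by_cases hI : j ∈ I <;> by_cases hJ : j ∈ J <;> simp_all [eSet]

theorem lat_eSet {n : ℕ} (I : Finset (Fin n)) : lat (eSet I) = I.card := by
  simp [lat, eSet]

theorem sum_eSet_mul_eSet {n : ℕ} (I J : Finset (Fin n)) :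
    ∑ i, eSet I i * eSet J i = ((I ∩ J).card : ℚ) := by
  rw [← lat_eSet, lat]
  refine Finset.sum_congr rfl fun i _ => ?_
  by_cases hI : i ∈ I <;> by_cases hJ : i ∈ J <;> simp [eSet, hI, hJ]

theorem form_eSet_eSet {k m : ℤ} (hm : m ≠ 0) {n : ℕ} {I J : Finset (Fin n)}
    (hI : (I.card : ℤ) = m) (hJ : (J.card : ℤ) = m) :
    form k m (eSet I) (eSet J) = ((I ∩ J).card : ℚ) + (k - m) := by
  have hI' : (I.card : ℚ) = m := by exact_mod_cast hI
  have hJ' : (J.card : ℚ) = m := by exact_mod_cast hJ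
  have hm' : (m : ℚ) ≠ 0 := by exact_mod_cast hm
  rw [form, sum_eSet_mul_eSet, lat_eSet, lat_eSet, hI', hJ']
  field_simp

/-- For `1 ≤ k ≤ m ≤ n - 1` and a family `ℬ` of `m`-element subsets of `{1, …, n}`,
the set `E(ℬ) = {e_I : I ∈ ℬ}` is an orthogonal `k`-frame of `L_{k,m,n}` (it has `n`
elements, each of squared norm `k`, pairwise orthogonal) if and only if `ℬ` has exactly
`n` blocks and any two distinct blocks meet in exactly `m - k` points, i.e.
`({1,…,n}, ℬ)` is a symmetric `2`-`(n, m, m-k)` design. -/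
theorem stmt18 (k m : ℤ) (n : ℕ) (hk : 1 ≤ k) (hkm : k ≤ m) (hm : m ≤ (n : ℤ) - 1)
    (ℬ : Finset (Finset (Fin n))) (hblocks : ∀ I ∈ ℬ, (I.card : ℤ) = m) :
    ((ℬ.image (fun I => eSet I)).card = n ∧
      (∀ I ∈ ℬ, form k m (eSet I) (eSet I) = (k : ℚ)) ∧
      (∀ I ∈ ℬ, ∀ J ∈ ℬ, eSet I ≠ eSet J → form k m (eSet I) (eSet J) = 0)) ↔
    (ℬ.card = n ∧ ∀ I ∈ ℬ, ∀ J ∈ ℬ, I ≠ J → ((I ∩ J).card : ℤ) = m - k) := by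
  have hm0 : m ≠ 0 := by lia
  rw [Finset.card_image_of_injective ℬ eSet_injective]
  refine and_congr_right fun _ => ?_
  have hnorm : ∀ I ∈ ℬ, form k m (eSet I) (eSet I) = (k : ℚ) := by
    intro I hI
    have hI' : (I.card : ℚ) = m := by exact_mod_cast hblocks I hI
    rw [form_eSet_eSet hm0 (hblocks I hI) (hblocks I hI), Finset.inter_self, hI']
    ring
  rw [and_iff_right hnorm]
  refine forall₄_congr fun I hI J hJ => ?_
  rw [eSet_injective.ne_iff, form_eSet_eSet hm0 (hblocks I hI) (hblocks J hJ)]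
  refine imp_congr_right fun _ => ?_
  rw [← @Int.cast_inj ℚ]
  push_cast
  constructor <;> intro h <;> linarith
end

section
/- The set of roots {x ∈ L_{2,3,8} : (x|x)_{2,3,8} = 2} has exactly 240 elements; that is, the lattice L_{2,3,8} (which is the E₈ lattice) has exactly 240 vectors of squared norm 2. -/
open Finset

/-- Prepending a coordinate to an integer vector, as an embedding. -/
def consEmbedding (n : ℕ) : (Σ _ : ℤ, Fin n → ℤ) ↪ (Fin (n + 1) → ℤ) where
  toFun p := Fin.cons p.1 p.2
  inj' := by
    rintro ⟨a, x⟩ ⟨b, y⟩ h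
    obtain ⟨rfl, rfl⟩ := Fin.cons_injective2 h
    rfl

/-- The integer vectors of length `n` with coordinate sum `s` and squared Euclidean norm `q`,
enumerated recursively; the Cauchy-Schwarz inequality cuts off empty branches. -/
noncomputable def vectorsOfSumOfNorm : (n : ℕ) → ℤ → ℤ → Finset (Fin n → ℤ)
  | 0, s, q => if s = 0 ∧ q = 0 then {Fin.elim0} else ∅
  | n + 1, s, q =>
    if (n + 1 : ℕ) * q < s ^ 2 then ∅
    else ((Finset.Icc (-q) q).sigma fun v => vectorsOfSumOfNorm n (s - v) (q - v ^ 2)).map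
      (consEmbedding n)

theorem mem_vectorsOfSumOfNorm {n : ℕ} {s q : ℤ} {x : Fin n → ℤ} :
    x ∈ vectorsOfSumOfNorm n s q ↔ ∑ i, x i = s ∧ ∑ i, x i ^ 2 = q := by
  induction n generalizing s q with
  | zero =>
    have hx : x = Fin.elim0 := Subsingleton.elim _ _
    by_cases h : s = 0 ∧ q = 0
    · simp [vectorsOfSumOfNorm, h, hx]
    · simp [vectorsOfSumOfNorm, h, eq_comm (a := (0 : ℤ))]
  | succ n ih =>
    rw [vectorsOfSumOfNorm]
    split_ifs with h
    · refine iff_of_false (Finset.notMem_empty x) ?_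
      rintro ⟨rfl, rfl⟩
      have := sq_sum_le_card_mul_sum_sq (s := Finset.univ) (f := x)
      rw [Finset.card_univ, Fintype.card_fin] at this
      exact this.not_gt h
    · simp only [Finset.mem_map, Finset.mem_sigma, Finset.mem_Icc, ih, Fin.sum_univ_succ]
      constructor
      · rintro ⟨⟨v, y⟩, ⟨-, hs, hq⟩, rfl⟩
        dsimp only at hs hq
        change v + ∑ i, y i = s ∧ v ^ 2 + ∑ i, y i ^ 2 = q
        constructor <;> linarith
      · rintro ⟨hs, hq⟩
        have hnonneg : 0 ≤ ∑ i : Fin n, x i.succ ^ 2 :=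
          Finset.sum_nonneg fun i _ => sq_nonneg _
        have hle := Int.le_self_sq (x 0)
        have hle' := Int.le_self_sq (-x 0)
        rw [neg_sq] at hle'
        refine ⟨⟨x 0, Fin.tail x⟩, ⟨⟨by linarith, by linarith⟩, ?_, ?_⟩, Fin.cons_self_tail x⟩ <;>
          simp only [Fin.tail] <;> linarith

/-- The integer vectors underlying the roots of `L_{2,3,8}`, sorted by latitude. -/
noncomputable def rootVectors : Finset (Fin 8 → ℤ) :=
  (Finset.Icc (-4 : ℤ) 4).biUnion fun t => vectorsOfSumOfNorm 8 (3 * t) (2 + t ^ 2)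

theorem mem_rootVectors {x : Fin 8 → ℤ} :
    x ∈ rootVectors ↔ ∃ t : ℤ, ∑ i, x i = 3 * t ∧ ∑ i, x i ^ 2 = 2 + t ^ 2 := by
  simp only [rootVectors, Finset.mem_biUnion, mem_vectorsOfSumOfNorm, Finset.mem_Icc]
  refine exists_congr fun t => and_iff_right_of_imp ?_
  rintro ⟨hs, hq⟩
  have := sq_sum_le_card_mul_sum_sq (s := Finset.univ) (f := x)
  rw [hs, hq, Finset.card_univ, Fintype.card_fin] at this
  push_cast at this
  constructor <;> nlinarith

theorem card_rootVectors : rootVectors.card = 240 := by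
  rw [rootVectors, Finset.card_biUnion]
  · decide +kernel
  · intro t _ t' _ h
    rw [Function.onFun, Finset.disjoint_left]
    intro x hx hx'
    rw [mem_vectorsOfSumOfNorm] at hx hx'
    exact h (by linarith [hx.1, hx'.1])

theorem intCast_mem_roots_iff {x : Fin 8 → ℤ} :
    ((fun i => (x i : ℚ)) ∈ latt 3 8 ∧ form 2 3 (fun i => (x i : ℚ)) (fun i => (x i : ℚ)) = 2) ↔
      x ∈ rootVectors := by
  have hlat : lat (fun i => (x i : ℚ)) = ((∑ i, x i : ℤ) : ℚ) := by simp [lat]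
  have hsq : ∑ i, (x i : ℚ) * x i = ((∑ i, x i ^ 2 : ℤ) : ℚ) := by simp [sq]
  simp only [mem_rootVectors, latt, form, Set.mem_ofPred_eq, hlat, hsq]
  constructor
  · rintro ⟨⟨-, t, ht⟩, hform⟩
    refine ⟨t, by exact_mod_cast ht, ?_⟩
    rw [ht] at hform
    push_cast at hform
    have : ((∑ i, x i ^ 2 : ℤ) : ℚ) = 2 + t ^ 2 := by push_cast; linarith
    exact_mod_cast this
  · rintro ⟨t, hs, hq⟩
    refine ⟨⟨fun i => ⟨x i, rfl⟩, t, by rw [hs]; push_cast; ring⟩, ?_⟩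
    rw [hs, hq]
    push_cast
    ring

/-- The lattice `L_{2,3,8}` (the `E₈` lattice) has exactly `240` roots, i.e. vectors of
squared norm `2`. -/
theorem stmt19 :
    Set.ncard {x : Fin 8 → ℚ | x ∈ latt 3 8 ∧ form 2 3 x x = 2} = 240 := by
  have himage : {x : Fin 8 → ℚ | x ∈ latt 3 8 ∧ form 2 3 x x = 2} =
      (fun (x : Fin 8 → ℤ) i => (x i : ℚ)) '' rootVectors := by
    ext x
    simp only [Set.mem_image, Finset.mem_coe, Set.mem_ofPred_eq, ← intCast_mem_roots_iff]
    constructor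
    · intro hx
      choose y hy using hx.1.1
      obtain rfl : x = fun i => (y i : ℚ) := funext hy
      exact ⟨y, hx, rfl⟩
    · rintro ⟨y, hy, rfl⟩
      exact hy
  have hinj : Function.Injective fun (x : Fin 8 → ℤ) i => (x i : ℚ) :=
    Function.Injective.comp_left Int.cast_injective
  rw [himage, Set.ncard_image_of_injective _ hinj,
    Set.ncard_coe_finset, card_rootVectors]
end
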